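/- Let (X,d) be a compact metric space, φ a continuous flow on X without fixed points, and μ a φ-invariant Borel probability measure. If Y⊂X satisfies μ(Y)=1, then h_μ(φ₁) ≤ h_top^B(φ, Y), where h_top^B(φ,Y) is the Bowen entropy of Y for the flow and h_μ(φ₁) is the measure-theoretic entropy of the time-one map. -/

import Mathlib

open MeasureTheory Filter Set Topology
open scoped ENNReal NNReal

namespace FlowEntropy

variable {X : Type*}

/-- A continuous flow on `X`. -/
structure IsFlow [TopologicalSpace X] (φ : ℝ → X → X) : Prop where
  cont : Continuous fun p : ℝ × X => φ p.1 p.2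
  map_zero : ∀ x, φ 0 x = x
  map_add : ∀ s t : ℝ, ∀ x, φ (s + t) x = φ s (φ t x)

/-- The flow has no fixed points. -/
def FixedPointFree (φ : ℝ → X → X) : Prop :=
  ∀ x : X, ∃ t : ℝ, φ t x ≠ x

/-- The measure `μ` is invariant under every time-`t` map of the flow. -/
def FlowInvariant [MeasurableSpace X] (φ : ℝ → X → X) (μ : Measure X) : Prop :=
  ∀ t : ℝ, MeasurePreserving (φ t) μ μ

/-- The measure `μ` is invariant and ergodic for the flow: every Borel set invariant
under all time-`t` maps has measure `0` or `1`. -/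
def FlowErgodic [MeasurableSpace X] (φ : ℝ → X → X) (μ : Measure X) : Prop :=
  FlowInvariant φ μ ∧
    ∀ B : Set X, MeasurableSet B → (∀ t : ℝ, φ t ⁻¹' B = B) → μ B = 0 ∨ μ B = 1

/-- `α` is a reparametrization on the closed interval `I` (containing the origin):
a continuous map that is a homeomorphism onto its image (equivalently, continuous and
injective on the compact interval), fixing the origin. -/
def IsReparOn (α : ℝ → ℝ) (I : Set ℝ) : Prop :=
  ContinuousOn α I ∧ Set.InjOn α I ∧ α 0 = 0

/-- The reparametrization ball `B(x, t, ε, φ)`. -/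
def reparBall [PseudoMetricSpace X] (φ : ℝ → X → X) (x : X) (t ε : ℝ) : Set X :=
  {y : X | ∃ α : ℝ → ℝ, IsReparOn α (Set.Icc 0 t) ∧
      ∀ s ∈ Set.Icc (0 : ℝ) t, dist (φ (α s) x) (φ s y) < ε}

/-- `M^s_{N,ε}(φ, Z)`: infimum of `Σ_i exp (-s t_i)` over countable families of
reparametrization balls `B(x_i, t_i, ε, φ)` with `t_i ≥ N` covering `Z`. -/
noncomputable def coverM [PseudoMetricSpace X] (φ : ℝ → X → X) (Z : Set X) (s : ℝ) (N : ℕ)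
    (ε : ℝ) : ℝ≥0∞ :=
  ⨅ (F : Set (X × ℝ)) (_ : F.Countable) (_ : ∀ p ∈ F, (N : ℝ) ≤ p.2)
    (_ : Z ⊆ ⋃ p ∈ F, reparBall φ p.1 p.2 ε),
    ∑' p : F, ENNReal.ofReal (Real.exp (-s * (p : X × ℝ).2))

/-- `M^s_ε(φ, Z) = lim_{N → ∞} M^s_{N,ε}(φ, Z)` (an increasing limit). -/
noncomputable def coverMeps [PseudoMetricSpace X] (φ : ℝ → X → X) (Z : Set X) (s ε : ℝ) :
    ℝ≥0∞ :=
  ⨆ N : ℕ, coverM φ Z s N ε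

/-- `M^s(φ, Z) = lim_{ε → 0} M^s_ε(φ, Z)` (an increasing limit as `ε` decreases). -/
noncomputable def coverMlim [PseudoMetricSpace X] (φ : ℝ → X → X) (Z : Set X) (s : ℝ) :
    ℝ≥0∞ :=
  ⨆ (ε : ℝ) (_ : 0 < ε), coverMeps φ Z s ε

/-- The Bowen entropy `h_top^B(φ, Z)`: the critical value where `M^s(φ,Z)` jumps
from `∞` to `0` (as an extended nonnegative real; `⊤` if no finite critical value). -/
noncomputable def bowenEntropy [PseudoMetricSpace X] (φ : ℝ → X → X) (Z : Set X) : ℝ≥0∞ :=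
  ⨅ (s : ℝ) (_ : 0 ≤ s) (_ : coverMlim φ Z s = 0), ENNReal.ofReal s

/-- Static entropy of a finite measurable partition, encoded as a map into a finite type. -/
noncomputable def partEnt [MeasurableSpace X] (μ : Measure X) {ι : Type*} [Fintype ι]
    (P : X → ι) : ℝ :=
  ∑ i : ι, Real.negMulLog ((μ (P ⁻¹' {i})).toReal)

/-- The measure-theoretic (Kolmogorov–Sinai) entropy of a map `T` with respect to `μ`:
the supremum over finite measurable partitions of the asymptotic entropy per unit time of
the dynamical refinements. -/
noncomputable def kolSinai [MeasurableSpace X] (μ : Measure X) (T : X → X) : ℝ≥0∞ :=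
  ⨆ (k : ℕ) (P : X → Fin k) (_ : Measurable P),
    Filter.limsup (fun n : ℕ =>
      ENNReal.ofReal (partEnt μ (fun x => fun j : Fin n => P (T^[(j : ℕ)] x)) / n))
      Filter.atTop

/-- `-log a` as a member of `ℝ≥0∞`, for `a ∈ [0,1]` (with `-log 0 = ∞`). -/
noncomputable def negLogNN (a : ℝ≥0∞) : ℝ≥0∞ :=
  if a = 0 then ⊤ else ENNReal.ofReal (-Real.log a.toReal)

/-- `-(1/t) log μ(B(x,t,ε,φ))`, as a member of `ℝ≥0∞`. -/
noncomputable def localRate [PseudoMetricSpace X] [MeasurableSpace X] (μ : Measure X)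
    (φ : ℝ → X → X) (x : X) (ε t : ℝ) : ℝ≥0∞ :=
  negLogNN (μ (reparBall φ x t ε)) / ENNReal.ofReal t

/-- The lower local entropy `underline h_μ(φ, x) = lim_{ε→0} liminf_{t→∞}
  -(1/t) log μ(B(x,t,ε,φ))` (the limit in `ε` is an increasing limit, hence a supremum). -/
noncomputable def lowerLocalEnt [PseudoMetricSpace X] [MeasurableSpace X] (μ : Measure X)
    (φ : ℝ → X → X) (x : X) : ℝ≥0∞ :=
  ⨆ (ε : ℝ) (_ : 0 < ε), Filter.liminf (fun t : ℝ => localRate μ φ x ε t) Filter.atTop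

/-- The upper local entropy `overline h_μ(φ, x) = lim_{ε→0} limsup_{t→∞}
  -(1/t) log μ(B(x,t,ε,φ))`. -/
noncomputable def upperLocalEnt [PseudoMetricSpace X] [MeasurableSpace X] (μ : Measure X)
    (φ : ℝ → X → X) (x : X) : ℝ≥0∞ :=
  ⨆ (ε : ℝ) (_ : 0 < ε), Filter.limsup (fun t : ℝ => localRate μ φ x ε t) Filter.atTop

/-- The set `G_μ(φ)` of generic points of `μ` for the flow `φ`. -/
def genericPts [TopologicalSpace X] [MeasurableSpace X] (φ : ℝ → X → X) (μ : Measure X) :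
    Set X :=
  {x : X | ∀ f : C(X, ℝ),
    Filter.Tendsto (fun t : ℝ => (1 / t) * ∫ τ in (0 : ℝ)..t, f (φ τ x))
      Filter.atTop (nhds (∫ y, f y ∂μ))}


/-- The itinerary of length `n` of `x` under `T` with respect to the labelling `P`. -/
def itinerary {A : Type*} (T : X → X) (P : X → A) : ℕ → X → List A
  | 0, _ => []
  | n + 1, x => P x :: itinerary T P n (T x)

section Itinerary

variable {A : Type*} (T : X → X) (P : X → A)

lemma length_itinerary (n : ℕ) (x : X) : (itinerary T P n x).length = n := by
  induction n generalizing x with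
  | zero => rfl
  | succ n ih => simp [itinerary, ih]

lemma itinerary_add (l r : ℕ) (x : X) :
    itinerary T P (l + r) x = itinerary T P l x ++ itinerary T P r (T^[l] x) := by
  induction l generalizing x with
  | zero => simp [itinerary]
  | succ l ih =>
    rw [show l + 1 + r = (l + r) + 1 by ring]
    simp [itinerary, ih, Function.iterate_succ_apply]

lemma ofFn_eq_itinerary (n : ℕ) (x : X) :
    List.ofFn (fun j : Fin n => P (T^[(j : ℕ)] x)) = itinerary T P n x := by
  induction n generalizing x with
  | zero => simp [itinerary]
  | succ n ih =>
    rw [List.ofFn_succ, itinerary, ← ih]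
    simp [Function.iterate_succ_apply]

end Itinerary

/-- If the itineraries can be decoded, piece by piece, from codewords of bounded length whose
weights satisfy Kraft's inequality, then words of every length carry weights of bounded total mass
which dominate `exp (-S_n g)` along itineraries. -/
lemma exists_word_weight {A : Type*} [Finite A] (T : X → X) (P : X → A) (g : X → ℝ)
    (hg : ∀ x, 0 ≤ g x) {ι : Type*} (dec : ι → List A) (W : ι → ℝ≥0∞) (hW : ∑' i, W i ≤ 1)
    (M : ℕ)
    (hdec : ∀ y, ∃ i, ∃ l, 1 ≤ l ∧ l ≤ M ∧ dec i = itinerary T P l y ∧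
      ENNReal.ofReal (Real.exp (-∑ j ∈ Finset.range l, g (T^[j] y))) ≤ W i) :
    ∃ C : ℝ, 0 < C ∧ ∀ n : ℕ, ∃ Q : List A → ℝ≥0∞, ∑' u, Q u ≤ ENNReal.ofReal C ∧
      ∀ x, ENNReal.ofReal (Real.exp (-∑ j ∈ Finset.range n, g (T^[j] x)))
        ≤ Q (itinerary T P n x) := by
  classical
  have hfin : {u : List A | u.length < M}.Finite := List.finite_length_lt A M
  refine ⟨hfin.toFinset.card + 1, by positivity, fun n => ?_⟩
  induction n using Nat.strong_induction_on with
  | _ n ih =>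
  rcases lt_or_ge n M with hn | hn
  · refine ⟨fun u => if u ∈ hfin.toFinset then 1 else 0, ?_, fun x => ?_⟩
    · rw [tsum_eq_sum (s := hfin.toFinset) (fun u hu => if_neg hu)]
      rw [Finset.sum_congr rfl (fun u hu => if_pos hu)]
      simp only [Finset.sum_const, nsmul_eq_mul, mul_one]
      rw [← ENNReal.ofReal_natCast]
      exact ENNReal.ofReal_le_ofReal (by linarith)
    · have hmem : itinerary T P n x ∈ hfin.toFinset := by
        simpa [length_itinerary] using hn
      simp only [if_pos hmem]
      rw [ENNReal.ofReal_le_one, Real.exp_le_one_iff]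
      have := Finset.sum_nonneg (fun j (_ : j ∈ Finset.range n) => hg (T^[j] x))
      linarith
  · choose! Q hQ hQx using ih
    refine ⟨fun u => ∑' p : ι × List A, if dec p.1 ++ p.2 = u ∧ 1 ≤ (dec p.1).length ∧
        (dec p.1).length ≤ n then W p.1 * Q (n - (dec p.1).length) p.2 else 0, ?_, fun x => ?_⟩
    · rw [ENNReal.tsum_comm]
      have h1 : ∀ p : ι × List A, (∑' u, if dec p.1 ++ p.2 = u ∧ 1 ≤ (dec p.1).length ∧
          (dec p.1).length ≤ n then W p.1 * Q (n - (dec p.1).length) p.2 else 0) =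
          if 1 ≤ (dec p.1).length ∧ (dec p.1).length ≤ n
            then W p.1 * Q (n - (dec p.1).length) p.2 else 0 := by
        intro p
        rw [tsum_eq_single (dec p.1 ++ p.2)]
        · simp
        · intro u hu
          exact if_neg (fun h => hu h.1.symm)
      simp_rw [h1]
      rw [ENNReal.summable.tsum_prod' fun _ => ENNReal.summable]
      calc _ ≤ ∑' i, W i * ENNReal.ofReal (hfin.toFinset.card + 1) := by
            refine ENNReal.tsum_le_tsum fun i => ?_
            by_cases hi : 1 ≤ (dec i).length ∧ (dec i).length ≤ n
            · simp only [hi, and_self, if_true]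
              rw [ENNReal.tsum_mul_left]
              gcongr
              exact hQ _ (by omega)
            · simp [hi]
        _ ≤ _ := by
            rw [ENNReal.tsum_mul_right]
            exact mul_le_of_le_one_left (zero_le) hW
    · obtain ⟨i, l, hl1, hlM, hi, hWi⟩ := hdec x
      have hlen : (dec i).length = l := by rw [hi, length_itinerary]
      have hln : l ≤ n := hlM.trans hn
      have hsum : ∑ j ∈ Finset.range n, g (T^[j] x) = ∑ j ∈ Finset.range l, g (T^[j] x) +
          ∑ j ∈ Finset.range (n - l), g (T^[j] (T^[l] x)) := by
        conv_lhs => rw [← Nat.add_sub_cancel' hln, Finset.sum_range_add]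
        simp only [← Function.iterate_add_apply, add_comm l]
      refine le_trans ?_ (ENNReal.le_tsum (i, itinerary T P (n - l) (T^[l] x)))
      rw [if_pos]
      · simp only [hlen]
        rw [hsum, neg_add, Real.exp_add, ENNReal.ofReal_mul (Real.exp_pos _).le]
        gcongr
        exact hQx _ (by omega) _
      · simp only [hlen]
        refine ⟨?_, hl1, hln⟩
        rw [hi, ← itinerary_add, Nat.add_sub_cancel' hln]

/-- Gibbs' inequality: the entropy of a partition is bounded by the mean codeword length. -/
lemma partEnt_le_log_add_integral [MeasurableSpace X] (μ : Measure X) [IsProbabilityMeasure μ]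
    {ι : Type*} [Fintype ι] [MeasurableSpace ι] [MeasurableSingletonClass ι]
    (P : X → ι) (hP : Measurable P) (w : ι → ℝ≥0∞) (C : ℝ) (hC : 0 < C)
    (hw : ∑ i, w i ≤ ENNReal.ofReal C) (f : X → ℝ) (hf : Integrable f μ)
    (hfw : ∀ x, ENNReal.ofReal (Real.exp (-f x)) ≤ w (P x)) :
    partEnt μ P ≤ Real.log C + ∫ x, f x ∂μ := by
  classical
  have hfinite : ∀ i, w i ≠ ⊤ := fun i =>
    ne_top_of_le_ne_top ENNReal.ofReal_ne_top
      ((Finset.single_le_sum (fun _ _ => zero_le) (Finset.mem_univ i)).trans hw)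
  set v : ι → ℝ := fun i => (w i).toReal with hv
  have hv0 : ∀ i, 0 ≤ v i := fun i => ENNReal.toReal_nonneg
  have hvC : ∑ i, v i ≤ C := by
    rw [hv, ← ENNReal.toReal_sum (fun i _ => hfinite i)]
    exact ENNReal.toReal_le_of_le_ofReal hC.le hw
  have hfv : ∀ x, Real.exp (-f x) ≤ v (P x) := fun x =>
    (ENNReal.ofReal_le_iff_le_toReal (hfinite _)).1 (hfw x)
  set p : ι → ℝ := fun i => (μ (P ⁻¹' {i})).toReal with hp
  have hms : ∀ i, MeasurableSet (P ⁻¹' {i}) := fun i => hP (measurableSet_singleton i)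
  have hone : ∑ i, p i = 1 := by
    have h := integral_fintype (μ := μ.map P) (f := fun _ : ι => (1 : ℝ)) (by simp)
    have : IsProbabilityMeasure (μ.map P) := Measure.isProbabilityMeasure_map hP.aemeasurable
    simp only [integral_const, probReal_univ, smul_eq_mul, mul_one] at h
    rw [h]
    refine Finset.sum_congr rfl fun i _ => ?_
    rw [hp, measureReal_def, Measure.map_apply hP (measurableSet_singleton i)]
  have hterm : ∀ i, Real.negMulLog (p i) ≤
      v i / C - p i + p i * Real.log C + ∫ x in P ⁻¹' {i}, f x ∂μ := by
    intro i
    rcases eq_or_ne (p i) 0 with h0 | h0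
    · have hz : μ (P ⁻¹' {i}) = 0 := by
        rcases (ENNReal.toReal_eq_zero_iff _).1 h0 with h | h
        · exact h
        · exact absurd h (measure_ne_top _ _)
      rw [h0, Measure.restrict_eq_zero.2 hz]
      simpa using div_nonneg (hv0 i) hC.le
    · have hp0 : 0 < p i := lt_of_le_of_ne ENNReal.toReal_nonneg h0.symm
      have hne : (P ⁻¹' {i}).Nonempty := by
        by_contra h
        rw [Set.not_nonempty_iff_eq_empty] at h
        exact h0 (by simp [hp, h])
      obtain ⟨x, hx⟩ := hne
      have hvi : 0 < v i := by
        have := hfv x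
        rw [show P x = i from hx] at this
        exact (Real.exp_pos _).trans_le this
      have hint : p i * (-Real.log (v i)) ≤ ∫ x in P ⁻¹' {i}, f x ∂μ := by
        have h := setIntegral_mono_on (μ := μ) (s := P ⁻¹' {i})
          (f := fun _ => -Real.log (v i)) (g := f) (by simp) hf.integrableOn (hms i) (by
            intro y hy
            have h1 := hfv y
            rw [show P y = i from hy] at h1
            have h2 := (Real.le_log_iff_exp_le hvi).2 h1
            linarith)
        simpa [measureReal_def, hp] using h
      have hlog := Real.log_le_sub_one_of_pos (show 0 < v i / C / p i by positivity)
      rw [Real.log_div (by positivity) hp0.ne', Real.log_div hvi.ne' hC.ne'] at hlog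
      have hmul := mul_le_mul_of_nonneg_left hlog hp0.le
      have hcancel : p i * (v i / C / p i - 1) = v i / C - p i := by
        field_simp
      rw [hcancel] at hmul
      rw [Real.negMulLog]
      nlinarith
  have hsplit : ∑ i, ∫ x in P ⁻¹' {i}, f x ∂μ = ∫ x, f x ∂μ := by
    rw [← integral_iUnion_fintype hms ?_ (fun i => hf.integrableOn)]
    · rw [show (⋃ i, P ⁻¹' {i}) = Set.univ by ext; simp, Measure.restrict_univ]
    · intro i j hij
      exact Disjoint.preimage P (by simpa using hij)
  calc partEnt μ P ≤ ∑ i, (v i / C - p i + p i * Real.log C + ∫ x in P ⁻¹' {i}, f x ∂μ) :=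
        Finset.sum_le_sum fun i _ => hterm i
    _ = (∑ i, v i) / C - 1 + Real.log C + ∫ x, f x ∂μ := by
        rw [Finset.sum_add_distrib, Finset.sum_add_distrib, Finset.sum_sub_distrib, hone, hsplit,
          ← Finset.sum_mul, hone, ← Finset.sum_div, one_mul]
    _ ≤ Real.log C + ∫ x, f x ∂μ := by
        have := (div_le_one hC).2 hvC
        linarith

/-- Under the hypotheses of `exists_word_weight`, the entropy rate of `P` is at most `∫ g`. -/
lemma limsup_partEnt_le_of_code [MeasurableSpace X] (μ : Measure X) [IsProbabilityMeasure μ]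
    (T : X → X) (hT : MeasurePreserving T μ μ) {k : ℕ} (P : X → Fin k) (hP : Measurable P)
    (g : X → ℝ) (hg : ∀ x, 0 ≤ g x) (hgi : Integrable g μ)
    {ι : Type*} (dec : ι → List (Fin k)) (W : ι → ℝ≥0∞) (hW : ∑' i, W i ≤ 1) (M : ℕ)
    (hdec : ∀ y, ∃ i, ∃ l, 1 ≤ l ∧ l ≤ M ∧ dec i = itinerary T P l y ∧
      ENNReal.ofReal (Real.exp (-∑ j ∈ Finset.range l, g (T^[j] y))) ≤ W i) :
    Filter.limsup (fun n : ℕ =>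
      ENNReal.ofReal (partEnt μ (fun x => fun j : Fin n => P (T^[(j : ℕ)] x)) / n))
      Filter.atTop ≤ ENNReal.ofReal (∫ x, g x ∂μ) := by
  obtain ⟨C, hC, hQ⟩ := exists_word_weight T P g hg dec W hW M hdec
  have hbound : ∀ n : ℕ, partEnt μ (fun x => fun j : Fin n => P (T^[(j : ℕ)] x)) ≤
      Real.log C + n * ∫ x, g x ∂μ := by
    intro n
    obtain ⟨Q, hQ1, hQ2⟩ := hQ n
    have hgj : ∀ j, Integrable (fun x => g (T^[j] x)) μ := fun j =>
      (hT.iterate j).integrable_comp_of_integrable hgi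
    have hint : ∫ x, ∑ j ∈ Finset.range n, g (T^[j] x) ∂μ = n * ∫ x, g x ∂μ := by
      rw [integral_finsetSum _ (fun j _ => hgj j)]
      have : ∀ j, ∫ x, g (T^[j] x) ∂μ = ∫ x, g x ∂μ := fun j => by
        have hm := (hT.iterate j).map_eq
        conv_rhs => rw [← hm]
        rw [integral_map (hT.iterate j).measurable.aemeasurable (by rw [hm]; exact hgi.1)]
      simp [this]
    rw [← hint]
    refine partEnt_le_log_add_integral μ _ ?_ (fun u => Q (List.ofFn u)) C hC ?_ _
      (integrable_finsetSum _ (fun j _ => hgj j)) ?_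
    · exact measurable_pi_lambda _ fun j => hP.comp (hT.iterate j).measurable
    · rw [← tsum_fintype (L := .unconditional _)]
      exact (ENNReal.tsum_comp_le_tsum_of_injective List.ofFn_injective Q).trans hQ1
    · intro x
      rw [ofFn_eq_itinerary]
      exact hQ2 x
  have hlim : Tendsto (fun n : ℕ => ENNReal.ofReal (Real.log C / n + ∫ x, g x ∂μ)) atTop
      (𝓝 (ENNReal.ofReal (∫ x, g x ∂μ))) := by
    refine ENNReal.tendsto_ofReal ?_
    simpa using (tendsto_const_div_atTop_nhds_zero_nat (Real.log C)).add_const (∫ x, g x ∂μ)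
  rw [← hlim.limsup_eq]
  refine limsup_le_limsup ?_
  filter_upwards [eventually_gt_atTop 0] with n hn
  refine ENNReal.ofReal_le_ofReal ?_
  have hn' : (0 : ℝ) < n := by exact_mod_cast hn
  rw [div_le_iff₀ hn', add_mul, div_mul_cancel₀ _ hn'.ne']
  linarith [hbound n]

lemma IsFlow.iterate_one [TopologicalSpace X] {φ : ℝ → X → X} (hφ : IsFlow φ) (j : ℕ)
    (x : X) : (φ 1)^[j] x = φ j x := by
  induction j with
  | zero => simp [hφ.map_zero]
  | succ j ih =>
    rw [Function.iterate_succ_apply', ih, ← hφ.map_add, Nat.cast_succ, add_comm]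

section Geometry

variable [MetricSpace X] [CompactSpace X] {φ : ℝ → X → X}

/-- A flow is uniformly continuous over bounded time intervals. -/
lemma IsFlow.exists_dist_lt (hφ : IsFlow φ) (b : ℝ) {ε : ℝ} (hε : 0 < ε) :
    ∃ ρ > 0, ∀ u ∈ Icc (-b) b, ∀ v ∈ Icc (-b) b, |u - v| < ρ → ∀ p q, dist p q < ρ →
      dist (φ u p) (φ v q) < ε := by
  have h := ((isCompact_Icc (a := -b) (b := b)).prod
    (isCompact_univ (X := X))).uniformContinuousOn_of_continuous hφ.cont.continuousOn
  obtain ⟨ρ, hρ, h⟩ := Metric.uniformContinuousOn_iff.1 h ε hε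
  refine ⟨ρ, hρ, fun u hu v hv huv p q hpq => ?_⟩
  exact h (u, p) ⟨hu, mem_univ _⟩ (v, q) ⟨hv, mem_univ _⟩ (max_lt huv hpq)

lemma IsFlow.exists_dist_self_lt (hφ : IsFlow φ) {ε : ℝ} (hε : 0 < ε) :
    ∃ τ > 0, ∀ u, |u| < τ → ∀ z, dist (φ u z) z < ε := by
  obtain ⟨ρ, hρ, h⟩ := hφ.exists_dist_lt 1 hε
  refine ⟨min ρ 1, by positivity, fun u hu z => ?_⟩
  have h1 := abs_lt.1 (hu.trans_le (min_le_right _ _))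
  have := h u ⟨h1.1.le, h1.2.le⟩ 0 (by simp) (by simpa using hu.trans_le (min_le_left _ _))
    z z (by simpa using hρ)
  rwa [hφ.map_zero] at this

/-- In a flow without fixed points, the periods of periodic orbits are bounded below. -/
lemma IsFlow.exists_period_lower_bound (hφ : IsFlow φ) (hfp : FixedPointFree φ) :
    ∃ τ > 0, ∀ u, 0 < u → u < τ → ∀ z, φ u z ≠ z := by
  by_contra! hcon
  have hpos : ∀ n : ℕ, (0 : ℝ) < 1 / (n + 1) := fun n => by positivity
  choose u hu0 hu1 z hz using fun n : ℕ => hcon (1 / (n + 1)) (hpos n)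
  obtain ⟨w, -, ψ, hψ, hw⟩ := isCompact_univ.tendsto_subseq (fun n => mem_univ (z n))
  obtain ⟨t, ht⟩ := hfp w
  have hu : Tendsto u atTop (𝓝 0) :=
    squeeze_zero (fun n => (hu0 n).le) (fun n => (hu1 n).le) tendsto_one_div_add_atTop_nhds_zero_nat
  have hper : ∀ n, ∀ j : ℕ, φ (j * u n) (z n) = z n := by
    intro n j
    induction j with
    | zero => simp [hφ.map_zero]
    | succ j ih =>
      rw [Nat.cast_succ, add_mul, one_mul, hφ.map_add, hz, ih]
  have hperz : ∀ n, ∀ j : ℤ, φ (j * u n) (z n) = z n := by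
    intro n j
    obtain ⟨j, rfl | rfl⟩ := j.eq_nat_or_neg
    · exact_mod_cast hper n j
    · conv_lhs => rw [← hper n j]
      rw [← hφ.map_add]
      simp [hφ.map_zero]
  have htime : Tendsto (fun n => (⌊t / u n⌋ : ℝ) * u n) atTop (𝓝 t) := by
    rw [tendsto_iff_dist_tendsto_zero]
    refine squeeze_zero (fun _ => dist_nonneg) (fun n => ?_) hu
    have h1 := Int.floor_le (t / u n)
    have h2 := Int.lt_floor_add_one (t / u n)
    rw [le_div_iff₀ (hu0 n)] at h1
    rw [div_lt_iff₀ (hu0 n), add_mul, one_mul] at h2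
    rw [Real.dist_eq, abs_le]
    constructor <;> linarith
  have hlim := (hφ.cont.tendsto (t, w)).comp
    ((htime.comp hψ.tendsto_atTop).prodMk_nhds hw)
  refine ht (tendsto_nhds_unique hlim ?_)
  refine hw.congr fun n => ?_
  exact (hperz (ψ n) _).symm

/-- Displacing points by a fixed time that is not a period moves them a definite amount. -/
lemma IsFlow.exists_le_dist_self (hφ : IsFlow φ) {u : ℝ} (hu : ∀ z, φ u z ≠ z) :
    ∃ κ > 0, ∀ z, κ ≤ dist (φ u z) z := by
  rcases isEmpty_or_nonempty X with hX | hX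
  · exact ⟨1, one_pos, fun z => hX.elim z⟩
  · have hc : Continuous fun z => dist (φ u z) z :=
      (hφ.cont.comp (by fun_prop : Continuous fun z : X => (u, z))).dist continuous_id
    obtain ⟨z₀, -, h⟩ := isCompact_univ.exists_isMinOn univ_nonempty hc.continuousOn
    exact ⟨_, dist_pos.2 (hu z₀), fun z => h (mem_univ z)⟩

/-- If an orbit piece shadows, up to a continuous time change, another one of bounded length, then
the time change is nearly a translation. -/
lemma IsFlow.exists_timeChange_close (hφ : IsFlow φ) {γ : ℝ} (hγ : 0 < γ)
    (hper : ∀ z, φ γ z ≠ z) (m : ℝ) :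
    ∃ ε > 0, ∀ b ≤ m, ∀ (x y : X) (α : ℝ → ℝ), ContinuousOn α (Icc 0 b) →
      (∀ s ∈ Icc (0 : ℝ) b, dist (φ (α s) x) (φ s y) < ε) →
      ∀ s ∈ Icc (0 : ℝ) b, |α s - α 0 - s| < γ := by
  have hper' : ∀ z, φ (-γ) z ≠ z := by
    intro z h
    apply hper z
    conv_lhs => rw [← h]
    rw [← hφ.map_add, add_neg_cancel, hφ.map_zero]
  obtain ⟨κ₁, hκ₁, h₁⟩ := hφ.exists_le_dist_self hper
  obtain ⟨κ₂, hκ₂, h₂⟩ := hφ.exists_le_dist_self hper'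
  set κ := min κ₁ κ₂ with hκ
  have hκ0 : 0 < κ := lt_min hκ₁ hκ₂
  obtain ⟨ρ, hρ, hu⟩ := hφ.exists_dist_lt m (half_pos hκ0)
  refine ⟨min ρ (κ / 2), by positivity, fun b hb x y α hα hclose s hs => ?_⟩
  have hb0 : 0 ≤ b := hs.1.trans hs.2
  have hne : ∀ r ∈ Icc (0 : ℝ) b, |α r - α 0 - r| ≠ γ := by
    intro r hr heq
    set z := φ r (φ (α 0) x) with hz
    have hz1 : dist (φ r y) z < κ / 2 := by
      rw [dist_comm]
      refine hu r ⟨by linarith [hr.1, hr.2], hr.2.trans hb⟩ r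
        ⟨by linarith [hr.1, hr.2], hr.2.trans hb⟩ (by simpa using hρ) _ _ ?_
      have := hclose 0 ⟨le_rfl, hb0⟩
      rw [hφ.map_zero] at this
      exact this.trans_le (min_le_left _ _)
    have hz2 : φ (α r - α 0 - r) z = φ (α r) x := by
      rw [hz, ← hφ.map_add, ← hφ.map_add]
      congr 1
      ring
    have hz3 : dist (φ (α r - α 0 - r) z) z < κ := by
      rw [hz2]
      have := (hclose r hr).trans_le (min_le_right _ _)
      linarith [dist_triangle (φ (α r) x) (φ r y) z]
    rcases (abs_eq hγ.le).1 heq with h | h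
    · rw [h] at hz3
      linarith [h₁ z, min_le_left κ₁ κ₂]
    · rw [h] at hz3
      linarith [h₂ z, min_le_right κ₁ κ₂]
  by_contra! hge
  have hcont : ContinuousOn (fun r => |α r - α 0 - r|) (Icc 0 s) :=
    (((hα.mono (Icc_subset_Icc_right hs.2)).sub continuousOn_const).sub continuousOn_id).abs
  obtain ⟨r, hr, hr'⟩ := intermediate_value_Icc hs.1 hcont
    (show γ ∈ Icc _ _ from ⟨by simpa using hγ.le, hge⟩)
  exact hne r ⟨hr.1, hr.2.trans hs.2⟩ hr'

lemma IsFlow.isOpen_reparBall (hφ : IsFlow φ) (x : X) (t ε : ℝ) :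
    IsOpen (reparBall φ x t ε) := by
  rw [Metric.isOpen_iff]
  rintro y ⟨α, hα, hy⟩
  obtain ⟨δ, hδ, hδy⟩ : ∃ δ > 0, ∀ s ∈ Icc (0 : ℝ) t, dist (φ (α s) x) (φ s y) + δ ≤ ε := by
    rcases (Icc (0 : ℝ) t).eq_empty_or_nonempty with h | h
    · exact ⟨1, one_pos, by simp [h]⟩
    · have hc : ContinuousOn (fun s => dist (φ (α s) x) (φ s y)) (Icc 0 t) :=
        continuous_dist.comp_continuousOn
          ((hφ.cont.comp_continuousOn (hα.1.prodMk continuousOn_const)).prodMk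
            (hφ.cont.comp_continuousOn (continuousOn_id.prodMk continuousOn_const)))
      obtain ⟨s₀, hs₀, hmax⟩ := isCompact_Icc.exists_isMaxOn h hc
      refine ⟨ε - dist (φ (α s₀) x) (φ s₀ y), by linarith [hy s₀ hs₀], fun s hs => ?_⟩
      have : dist (φ (α s) x) (φ s y) ≤ dist (φ (α s₀) x) (φ s₀ y) := hmax hs
      linarith
  obtain ⟨ρ, hρ, hu⟩ := hφ.exists_dist_lt t hδ
  refine ⟨ρ, hρ, fun y' hy' => ⟨α, hα, fun s hs => ?_⟩⟩
  have hs' : s ∈ Icc (-t) t := ⟨by linarith [hs.1, hs.2], hs.2⟩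
  have := hu s hs' s hs' (by simpa using hρ) y y' (by rwa [dist_comm])
  linarith [hδy s hs, dist_triangle (φ (α s) x) (φ s y) (φ s y')]

/-- At the scale `ε`, the points of a reparametrization ball have at most `3` itineraries for every
`m` units of time, at the times when their orbits visit a set `G` on which the labelling `P` is read
off from nearby points. -/
lemma IsFlow.exists_reference_words (hφ : IsFlow φ) (hfp : FixedPointFree φ) {A : Type*}
    (P : X → A) (G : Set X) (ref : X → A) {ρ : ℝ} (hρ : 0 < ρ)
    (href : ∀ z, ∀ w ∈ G, dist z w < ρ → P w = ref z) (m : ℕ) :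
    ∃ ε > 0, ∀ (b : ℕ) (x : X), ∃ R : Finset (ℕ → A), R.card ≤ 3 ^ b ∧
      ∀ (n : ℕ), n ≤ b * m → ∀ (y : X) (α : ℝ → ℝ), ContinuousOn α (Icc 0 n) →
      (∀ s ∈ Icc (0 : ℝ) n, dist (φ (α s) x) (φ s y) < ε) → α 0 = 0 →
      ∃ r ∈ R, ∀ j < n, (φ 1)^[j] y ∈ G → P ((φ 1)^[j] y) = r j := by
  classical
  obtain ⟨τ₁, hτ₁, hτ₁'⟩ := hφ.exists_period_lower_bound hfp
  obtain ⟨τ₂, hτ₂, hτ₂'⟩ := hφ.exists_dist_self_lt (half_pos hρ)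
  set γ := min (τ₁ / 2) (τ₂ / 3) with hγ
  have hγ0 : 0 < γ := by positivity
  have hγ1 : γ < τ₁ := (min_le_left _ _).trans_lt (by linarith)
  have hγ2 : 2 * γ < τ₂ := by
    have := min_le_right (τ₁ / 2) (τ₂ / 3)
    linarith
  obtain ⟨ε, hε, htc⟩ := hφ.exists_timeChange_close hγ0 (hτ₁' γ hγ0 hγ1) m
  refine ⟨min ε (ρ / 2), by positivity, ?_⟩
  suffices h : ∀ (b : ℕ) (x : X), ∃ R : Finset (ℕ → A), R.card ≤ 3 ^ b ∧ R.Nonempty ∧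
      ∀ (n : ℕ), n ≤ b * m → ∀ (y : X) (α : ℝ → ℝ), ContinuousOn α (Icc 0 n) →
      (∀ s ∈ Icc (0 : ℝ) n, dist (φ (α s) x) (φ s y) < min ε (ρ / 2)) → |α 0| ≤ γ →
      ∃ r ∈ R, ∀ j < n, (φ 1)^[j] y ∈ G → P ((φ 1)^[j] y) = r j by
    intro b x
    obtain ⟨R, hR1, -, hR⟩ := h b x
    exact ⟨R, hR1, fun n hn y α hα hcl h0 => hR n hn y α hα hcl (by simpa [h0] using hγ0.le)⟩
  intro b
  induction b with
  | zero =>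
    intro x
    refine ⟨{fun _ => ref x}, by simp, by simp, fun n hn y α _ _ _ => ⟨_, by simp; rfl, ?_⟩⟩
    intro j hj
    omega
  | succ b ih =>
    intro x
    choose R hR1 hR2 hR using fun o : ℤ => ih (φ (m + o * γ) x)
    set join : (ℕ → A) → ℕ → A := fun r j => if j < m then ref (φ j x) else r (j - m) with hjoin
    refine ⟨(Finset.Icc (-1 : ℤ) 1).biUnion fun o => (R o).image join, ?_, ?_, ?_⟩
    · refine (Finset.card_biUnion_le_card_mul _ _ (3 ^ b) fun o _ =>
        Finset.card_image_le.trans (hR1 o)).trans ?_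
      simp [pow_succ, mul_comm]
    · obtain ⟨r, hr⟩ := hR2 0
      exact ⟨join r, Finset.mem_biUnion.2 ⟨0, by simp, Finset.mem_image_of_mem _ hr⟩⟩
    intro n hn y α hα hcl h0
    have hfirst : ∀ j : ℕ, j < n → j < m → (φ 1)^[j] y ∈ G → P ((φ 1)^[j] y) = ref (φ j x) := by
      intro j hjn hjm hG
      have hjn' : (j : ℝ) ≤ n := by exact_mod_cast hjn.le
      have hjm' : (j : ℝ) ≤ m := by exact_mod_cast hjm.le
      have hj0 : (0 : ℝ) ≤ j := by positivity
      have hsub : Icc (0 : ℝ) j ⊆ Icc 0 n := Icc_subset_Icc_right hjn'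
      have hd := htc j hjm' x y α (hα.mono hsub)
        (fun s hs => (hcl s (hsub hs)).trans_le (min_le_left _ _)) j ⟨hj0, le_rfl⟩
      refine href _ _ hG ?_
      rw [hφ.iterate_one]
      have h1 : dist (φ (α j) x) (φ j x) < ρ / 2 := by
        have := hτ₂' (α j - j) ?_ (φ j x)
        · rwa [← hφ.map_add, sub_add_cancel] at this
        · rw [abs_le] at h0
          rw [abs_lt] at hd ⊢
          constructor <;> linarith
      have h2 := (hcl j ⟨hj0, hjn'⟩).trans_le (min_le_right _ _)
      rw [dist_comm] at h1
      linarith [dist_triangle (φ j x) (φ (α j) x) (φ j y)]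
    rcases lt_or_ge n m with hnm | hnm
    · obtain ⟨r, hr⟩ := hR2 0
      refine ⟨join r, Finset.mem_biUnion.2 ⟨0, by simp, Finset.mem_image_of_mem _ hr⟩, ?_⟩
      intro j hj hG
      simp only [hjoin, if_pos (hj.trans hnm)]
      exact hfirst j hj (hj.trans hnm) hG
    · have hnm' : (m : ℝ) ≤ n := by exact_mod_cast hnm
      have hm0 : (0 : ℝ) ≤ m := by positivity
      have hsub : Icc (0 : ℝ) m ⊆ Icc 0 n := Icc_subset_Icc_right hnm'
      have hd := htc m le_rfl x y α (hα.mono hsub)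
        (fun s hs => (hcl s (hsub hs)).trans_le (min_le_left _ _)) m ⟨hm0, le_rfl⟩
      obtain ⟨o, ho, hoγ⟩ : ∃ o ∈ Finset.Icc (-1 : ℤ) 1, |α m - m - o * γ| ≤ γ := by
        rw [abs_le] at h0
        rw [abs_lt] at hd
        rcases le_total (α m - m) (-γ) with h | h
        · exact ⟨-1, by simp, by rw [abs_le]; push_cast; constructor <;> linarith⟩
        rcases le_total (α m - m) γ with h' | h'
        · exact ⟨0, by simp, by rw [abs_le]; push_cast; constructor <;> linarith⟩
        · exact ⟨1, by simp, by rw [abs_le]; push_cast; constructor <;> linarith⟩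
      have hcast : ((n - m : ℕ) : ℝ) = n - m := by push_cast [hnm]; ring
      have hmaps : MapsTo (fun s : ℝ => m + s) (Icc 0 ((n - m : ℕ) : ℝ)) (Icc 0 n) := by
        intro s hs
        rw [hcast] at hs
        exact ⟨by linarith [hs.1], by linarith [hs.2]⟩
      obtain ⟨r, hr, hrj⟩ := hR o (n - m) (by rw [add_mul] at hn; omega) (φ m y)
        (fun s => α (m + s) - m - o * γ)
        (((hα.comp (by fun_prop) hmaps).sub continuousOn_const).sub continuousOn_const)
        (by
          intro s hs
          have := hcl _ (hmaps hs)
          rw [← hφ.map_add, ← hφ.map_add]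
          convert this using 3 <;> ring)
        (by simpa using hoγ)
      refine ⟨join r, Finset.mem_biUnion.2 ⟨o, ho, Finset.mem_image_of_mem _ hr⟩, ?_⟩
      intro j hj hG
      rcases lt_or_ge j m with hjm | hjm
      · simp only [hjoin, if_pos hjm]
        exact hfirst j hj hjm hG
      · simp only [hjoin, if_neg (not_lt.2 hjm)]
        have hit : (φ 1)^[j - m] (φ m y) = (φ 1)^[j] y := by
          rw [← hφ.iterate_one, ← Function.iterate_add_apply, Nat.sub_add_cancel hjm]
        have := hrj (j - m) (by omega)
        rw [hit] at this
        exact this hG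

/-- A finite measurable labelling is locally constant on a set of nearly full measure. -/
lemma exists_nearly_full_locally_constant [MeasurableSpace X] [BorelSpace X] (μ : Measure X)
    [IsProbabilityMeasure μ] {k : ℕ} (P : X → Fin k) (hP : Measurable P) {δ : ℝ} (hδ : 0 < δ) :
    ∃ (G : Set X) (ref : X → Fin k) (ρ : ℝ), MeasurableSet G ∧ μ Gᶜ ≤ ENNReal.ofReal δ ∧ 0 < ρ ∧
      ∀ z, ∀ w ∈ G, dist z w < ρ → P w = ref z := by
  classical
  have hk : 0 < (k : ℝ) := by
    obtain ⟨x⟩ := nonempty_of_isProbabilityMeasure μ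
    exact_mod_cast Fin.pos (P x)
  have hms : ∀ i, MeasurableSet (P ⁻¹' {i}) := fun i => hP (measurableSet_singleton i)
  have hδk : ENNReal.ofReal (δ / k) ≠ 0 := by
    simpa using div_pos hδ hk
  choose K hKP hK hKμ using fun i => (hms i).exists_isClosed_sdiff_lt (measure_ne_top μ _) hδk
  have hdisj : ∀ i j, i ≠ j → Disjoint (K i) (K j) := fun i j hij =>
    ((Set.disjoint_singleton.2 hij).preimage P).mono (hKP i) (hKP j)
  have hthick : ∀ᶠ ρ in 𝓝[>] (0 : ℝ), ∀ i j, i ≠ j →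
      Disjoint (Metric.thickening ρ (K i)) (Metric.thickening ρ (K j)) := by
    refine eventually_all.2 fun i => eventually_all.2 fun j => eventually_imp_distrib_left.2 ?_
    intro hij
    obtain ⟨ρ, hρ, h⟩ := (hdisj i j hij).exists_thickenings (hK i).isCompact (hK j)
    filter_upwards [Ioo_mem_nhdsGT hρ] with r hr
    exact h.mono (Metric.thickening_mono hr.2.le _) (Metric.thickening_mono hr.2.le _)
  obtain ⟨ρ, hρK, hρ⟩ := (hthick.and self_mem_nhdsWithin).exists
  have hρ0 : 0 < ρ := hρ
  refine ⟨⋃ i, K i, fun z => if h : ∃ i, z ∈ Metric.thickening ρ (K i) then h.choose else P z, ρ,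
    MeasurableSet.iUnion fun i => (hK i).measurableSet, ?_, hρ0, ?_⟩
  · have hsub : (⋃ i, K i)ᶜ ⊆ ⋃ i, (P ⁻¹' {i} \ K i) := by
      intro x hx
      simp only [mem_compl_iff, mem_iUnion, not_exists] at hx
      exact mem_iUnion.2 ⟨P x, rfl, hx _⟩
    calc μ (⋃ i, K i)ᶜ ≤ ∑ i, μ (P ⁻¹' {i} \ K i) :=
          (measure_mono hsub).trans (measure_iUnion_fintype_le μ _)
      _ ≤ ∑ _i : Fin k, ENNReal.ofReal (δ / k) := Finset.sum_le_sum fun i _ => (hKμ i).le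
      _ = ENNReal.ofReal δ := by
          rw [Finset.sum_const, Finset.card_univ, Fintype.card_fin, nsmul_eq_mul,
            ← ENNReal.ofReal_natCast, ← ENNReal.ofReal_mul hk.le, mul_div_cancel₀ _ hk.ne']
  · intro z w hw hzw
    obtain ⟨i, hi⟩ := mem_iUnion.1 hw
    have hz : z ∈ Metric.thickening ρ (K i) := Metric.mem_thickening_iff.2 ⟨w, hi, hzw⟩
    have hex : ∃ i, z ∈ Metric.thickening ρ (K i) := ⟨i, hz⟩
    simp only [dif_pos hex, show P w = i from hKP i hi]
    by_contra hne
    exact Set.disjoint_left.1 (hρK _ _ hne) hz hex.choose_spec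

end Geometry

section Coding

/-- The weight of the letter `a` when the letter `r` is expected. -/
noncomputable def letterWeight (k : ℕ) (β : ℝ) (a r : Fin k) : ℝ :=
  if a = r then Real.exp (-β) else (1 - Real.exp (-β)) / k

/-- The cost of recording an unexpected letter. -/
noncomputable def mismatchCost (k : ℕ) (β : ℝ) : ℝ :=
  Real.log (k / (1 - Real.exp (-β)))

variable {k : ℕ} {β : ℝ}

lemma one_sub_exp_neg_pos (hβ : 0 < β) : 0 < 1 - Real.exp (-β) := by
  have : Real.exp (-β) < 1 := by
    rw [Real.exp_lt_one_iff]
    linarith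
  linarith

lemma mismatchCost_nonneg (hk : 0 < k) (hβ : 0 < β) : 0 ≤ mismatchCost k β := by
  have hk' : (1 : ℝ) ≤ k := by exact_mod_cast hk
  refine Real.log_nonneg ?_
  rw [one_le_div (one_sub_exp_neg_pos hβ)]
  linarith [Real.exp_pos (-β)]

lemma exp_neg_mismatchCost (hk : 0 < k) (hβ : 0 < β) :
    Real.exp (-mismatchCost k β) = (1 - Real.exp (-β)) / k := by
  have hk' : (0 : ℝ) < k := by exact_mod_cast hk
  rw [mismatchCost, Real.exp_neg, Real.exp_log (div_pos hk' (one_sub_exp_neg_pos hβ)), inv_div]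

lemma letterWeight_nonneg (hβ : 0 < β) (a r : Fin k) : 0 ≤ letterWeight k β a r := by
  unfold letterWeight
  split_ifs
  · positivity
  · exact div_nonneg (one_sub_exp_neg_pos hβ).le (Nat.cast_nonneg k)

lemma exp_neg_le_letterWeight (hk : 0 < k) (hβ : 0 < β) (a r : Fin k) :
    Real.exp (-(β + mismatchCost k β)) ≤ letterWeight k β a r := by
  have hL := mismatchCost_nonneg hk hβ
  unfold letterWeight
  split_ifs
  · exact Real.exp_le_exp.2 (by linarith)
  · rw [← exp_neg_mismatchCost hk hβ]
    exact Real.exp_le_exp.2 (by linarith)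

lemma sum_letterWeight_le_one (hβ : 0 < β) (r : Fin k) : ∑ a, letterWeight k β a r ≤ 1 := by
  have hk' : (0 : ℝ) < k := by exact_mod_cast Fin.pos r
  have hη := one_sub_exp_neg_pos hβ
  calc ∑ a, letterWeight k β a r
      ≤ ∑ a, ((if a = r then Real.exp (-β) else 0) + (1 - Real.exp (-β)) / k) := by
        refine Finset.sum_le_sum fun a _ => ?_
        unfold letterWeight
        split_ifs
        · linarith [div_pos hη hk']
        · simp
    _ = 1 := by
        rw [Finset.sum_add_distrib, Finset.sum_ite_eq' Finset.univ r]
        simp only [Finset.mem_univ, if_true, Finset.sum_const, Finset.card_univ, Fintype.card_fin,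
          nsmul_eq_mul]
        field_simp
        ring

lemma sum_prod_letterWeight_le_one (hβ : 0 < β) {n : ℕ} (r : Fin n → Fin k) :
    ∑ u : Fin n → Fin k, ∏ j, letterWeight k β (u j) (r j) ≤ 1 := by
  have h := Finset.prod_univ_sum (fun _ : Fin n => (Finset.univ : Finset (Fin k)))
    (fun j a => letterWeight k β a (r j))
  rw [Fintype.piFinset_univ] at h
  rw [← h]
  exact Finset.prod_le_one
    (fun j _ => Finset.sum_nonneg fun a _ => letterWeight_nonneg hβ a (r j))
    (fun j _ => sum_letterWeight_le_one hβ (r j))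

end Coding

section Cover

variable [MetricSpace X] {φ : ℝ → X → X} {Y : Set X} {s : ℝ}

/-- If `M^s(φ, Y) = 0`, then `Y` has countable covers by long reparametrization balls of arbitrarily
small total weight. -/
lemma exists_cover_of_coverMlim_eq_zero (h : coverMlim φ Y s = 0) {ε θ : ℝ} (hε : 0 < ε)
    (hθ : 0 < θ) (N : ℕ) :
    ∃ F : Set (X × ℝ), (∀ p ∈ F, (N : ℝ) ≤ p.2) ∧ Y ⊆ ⋃ p ∈ F, reparBall φ p.1 p.2 ε ∧
      ∀ F₀ : Finset (X × ℝ), ↑F₀ ⊆ F → ∑ p ∈ F₀, Real.exp (-s * p.2) ≤ θ := by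
  have hN : coverM φ Y s N ε = 0 := by
    refine le_antisymm ?_ zero_le
    rw [← h]
    exact (le_iSup (fun N => coverM φ Y s N ε) N).trans
      (le_iSup₂ (f := fun (ε : ℝ) (_ : 0 < ε) => coverMeps φ Y s ε) ε hε)
  have hlt : coverM φ Y s N ε < ENNReal.ofReal θ := by
    rw [hN]
    exact ENNReal.ofReal_pos.2 hθ
  simp only [coverM, iInf_lt_iff] at hlt
  obtain ⟨F, -, hFN, hFY, hF⟩ := hlt
  refine ⟨F, hFN, hFY, fun F₀ hF₀ => ?_⟩
  rw [← ENNReal.ofReal_le_ofReal_iff hθ.le, ENNReal.ofReal_sum_of_nonneg fun _ _ => by positivity]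
  refine le_trans ?_ hF.le
  rw [tsum_subtype F fun p : X × ℝ => ENNReal.ofReal (Real.exp (-s * p.2))]
  refine le_trans (le_of_eq ?_) (ENNReal.sum_le_tsum F₀)
  exact Finset.sum_congr rfl fun p hp => by
    rw [Set.indicator_of_mem (hF₀ hp)]

/-- Finitely many members of an open cover of a set of full measure cover a compact set of nearly
full measure. -/
lemma exists_isCompact_nearly_full [MeasurableSpace X] [BorelSpace X] [CompactSpace X]
    (μ : Measure X) [IsProbabilityMeasure μ] (hY : μ Y = 1) {ι : Type*} (F : Set ι) (B : ι → Set X)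
    (hB : ∀ i ∈ F, IsOpen (B i)) (hYB : Y ⊆ ⋃ i ∈ F, B i) {δ : ℝ} (hδ : 0 < δ) :
    ∃ (K : Set X) (F₀ : Finset ι), IsCompact K ∧ μ Kᶜ ≤ ENNReal.ofReal δ ∧ ↑F₀ ⊆ F ∧
      K ⊆ ⋃ i ∈ F₀, B i := by
  have hU : μ (⋃ i ∈ F, B i) = 1 := le_antisymm prob_le_one (hY ▸ measure_mono hYB)
  have hlt : 1 - ENNReal.ofReal δ < μ (⋃ i ∈ F, B i) := by
    rw [hU]
    exact ENNReal.sub_lt_self ENNReal.one_ne_top one_ne_zero (ENNReal.ofReal_pos.2 hδ).ne'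
  obtain ⟨K, hKU, hK, hKμ⟩ := (isOpen_biUnion hB).exists_lt_isCompact hlt
  obtain ⟨b, hbF, hb, hKb⟩ := hK.elim_finite_subcover_image hB hKU
  refine ⟨K, hb.toFinset, hK, ?_, by simpa using hbF, by simpa using hKb⟩
  rw [prob_compl_eq_one_sub hK.measurableSet, tsub_le_iff_tsub_le]
  exact hKμ.le

end Cover

/-- If `M^s(φ, Y) = 0` for a set `Y` of full measure, then no finite partition has entropy rate
larger than `s`. -/
lemma limsup_partEnt_le_of_coverMlim_eq_zero [MetricSpace X] [CompactSpace X] [MeasurableSpace X]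
    [BorelSpace X] {φ : ℝ → X → X} (hφ : IsFlow φ) (hfp : FixedPointFree φ) (μ : Measure X)
    [IsProbabilityMeasure μ] (hinv : FlowInvariant φ μ) {Y : Set X} (hY : μ Y = 1) {s : ℝ}
    (hs : 0 ≤ s) (hM : coverMlim φ Y s = 0) {k : ℕ} (P : X → Fin k) (hP : Measurable P)
    {β : ℝ} (hβ : 0 < β) :
    Filter.limsup (fun n : ℕ =>
      ENNReal.ofReal (partEnt μ (fun x => fun j : Fin n => P ((φ 1)^[(j : ℕ)] x)) / n))
      Filter.atTop ≤ ENNReal.ofReal (s + 4 * β) := by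
  classical
  have hk : 0 < k := by
    obtain ⟨x⟩ := nonempty_of_isProbabilityMeasure μ
    exact Fin.pos (P x)
  have hk' : (1 : ℝ) ≤ k := by exact_mod_cast hk
  set L := mismatchCost k β with hL
  have hL0 : 0 ≤ L := mismatchCost_nonneg hk hβ
  set L' := Real.log (2 * k) with hL'
  have hL'0 : 0 ≤ L' := Real.log_nonneg (by linarith)
  have hlog3 : 0 < Real.log 3 := Real.log_pos (by norm_num)
  obtain ⟨m, hm⟩ := exists_nat_gt (Real.log 3 / β)
  have hm0 : (0 : ℝ) < m := (div_pos hlog3 hβ).trans hm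
  set κ := Real.log 3 / m with hκ
  have hκ0 : 0 < κ := div_pos hlog3 hm0
  have hκβ : κ ≤ β := by
    rw [div_lt_iff₀ hβ] at hm
    rw [hκ, div_le_iff₀ hm0]
    linarith
  obtain ⟨G, ref, ρ, hG, hGμ, hρ, href⟩ :=
    exists_nearly_full_locally_constant μ P hP (δ := β / (L + 1)) (by positivity)
  obtain ⟨ε, hε, hwords⟩ := hφ.exists_reference_words hfp P G ref hρ href m
  obtain ⟨F, hF1, hFY, hFsum⟩ := exists_cover_of_coverMlim_eq_zero hM hε
    (θ := Real.exp (-s) / 6) (by positivity) 1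
  obtain ⟨K, F₀, hK, hKμ, hF₀, hKF₀⟩ := exists_isCompact_nearly_full μ hY F
    (fun p => reparBall φ p.1 p.2 ε) (fun p _ => hφ.isOpen_reparBall _ _ _) hFY
    (δ := β / (L' + 1)) (by positivity)
  set N : X × ℝ → ℕ := fun p => ⌊p.2⌋₊ with hN
  choose R hRcard hR using fun p : X × ℝ => hwords (N p / m + 1) p.1
  set g : X → ℝ := fun x => (s + κ + β) + (Gᶜ.indicator (fun _ => L) x +
    Kᶜ.indicator (fun _ => L') x) with hg
  have hindG : ∀ x, 0 ≤ Gᶜ.indicator (fun _ => L) x := Set.indicator_nonneg fun _ _ => hL0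
  have hindK : ∀ x, 0 ≤ Kᶜ.indicator (fun _ => L') x := Set.indicator_nonneg fun _ _ => hL'0
  have hg0 : ∀ x, 0 ≤ g x := fun x => by
    have := hindG x
    have := hindK x
    simp only [hg]
    linarith
  have hGi : Integrable (Gᶜ.indicator fun _ => L) μ := (integrable_const L).indicator hG.compl
  have hKi : Integrable (Kᶜ.indicator fun _ => L') μ :=
    (integrable_const L').indicator hK.measurableSet.compl
  have hgi : Integrable g μ := (integrable_const _).add (hGi.add hKi)
  have hmass : ∀ {S : Set X} {c : ℝ}, 0 ≤ c → μ S ≤ ENNReal.ofReal (β / (c + 1)) →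
      μ.real S * c ≤ β := by
    intro S c hc hS
    have h1 : μ.real S ≤ β / (c + 1) := ENNReal.toReal_le_of_le_ofReal (by positivity) hS
    rw [le_div_iff₀ (by positivity)] at h1
    nlinarith [measureReal_nonneg (μ := μ) (s := S)]
  have hgint : ∫ x, g x ∂μ ≤ s + 4 * β := by
    have h1 : ∫ x, g x ∂μ = (s + κ + β) + (μ.real Gᶜ * L + μ.real Kᶜ * L') := by
      have h2 := integral_add (integrable_const (μ := μ) (s + κ + β)) (hGi.add hKi)
      simp only [Pi.add_apply] at h2
      rw [hg, h2, integral_add hGi hKi,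
        integral_indicator_const _ hG.compl, integral_indicator_const _ hK.measurableSet.compl]
      simp
    linarith [hmass hL0 hGμ, hmass hL'0 hKμ]
  set E : X × ℝ → ℝ := fun p => Real.exp (-(s + κ) * N p) with hE
  have hEcard : ∀ p, E p * (R p).card ≤ 3 * Real.exp s * Real.exp (-s * p.2) := by
    intro p
    have h1 : ((R p).card : ℝ) ≤ 3 * Real.exp (κ * N p) := by
      have h3 : (3 : ℝ) ^ (N p / m) ≤ Real.exp (κ * N p) := by
        rw [← Real.exp_log (show (0 : ℝ) < 3 ^ (N p / m) by positivity), Real.log_pow]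
        refine Real.exp_le_exp.2 ?_
        have := Nat.cast_div_le (α := ℝ) (m := N p) (n := m)
        calc _ ≤ (N p / m : ℝ) * Real.log 3 := by gcongr
          _ = κ * N p := by rw [hκ]; ring
      have h4 : ((R p).card : ℝ) ≤ 3 ^ (N p / m + 1) := by exact_mod_cast hRcard p
      rw [pow_succ] at h4
      linarith
    have h2 : p.2 < N p + 1 := Nat.lt_floor_add_one p.2
    calc E p * (R p).card ≤ E p * (3 * Real.exp (κ * N p)) := by gcongr
      _ = 3 * Real.exp (-s * N p) := by
          rw [hE, mul_left_comm, ← Real.exp_add]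
          ring_nf
      _ ≤ 3 * Real.exp (s + -s * p.2) := by
          gcongr
          nlinarith
      _ = _ := by rw [Real.exp_add, mul_assoc]
  let W : Fin k ⊕ (Σ p : F₀, R p × (Fin (N p) → Fin k)) → ℝ := Sum.elim (fun _ => 1 / (2 * k))
    fun c => E c.1 * ∏ j, letterWeight k β (c.2.2 j) (c.2.1.1 j)
  let dec : Fin k ⊕ (Σ p : F₀, R p × (Fin (N p) → Fin k)) → List (Fin k) :=
    Sum.elim (fun a => [a]) fun c => List.ofFn c.2.2
  have hW0 : ∀ c, 0 ≤ W c := by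
    rintro (a | c)
    · simp only [W, Sum.elim_inl]
      positivity
    · exact mul_nonneg (Real.exp_pos _).le
        (Finset.prod_nonneg fun j _ => letterWeight_nonneg hβ _ _)
  have hWsum : ∑ c, W c ≤ 1 := by
    have hball : ∀ p : F₀, ∑ c : R p × (Fin (N p) → Fin k), W (Sum.inr ⟨p, c⟩) ≤
        3 * Real.exp s * Real.exp (-s * p.1.2) := by
      intro p
      refine le_trans ?_ (hEcard p)
      simp only [W, Sum.elim_inr, Fintype.sum_prod_type, ← Finset.mul_sum]
      refine mul_le_mul_of_nonneg_left ?_ (Real.exp_pos _).le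
      calc _ ≤ ∑ _r : R p, (1 : ℝ) := Finset.sum_le_sum fun r _ =>
              sum_prod_letterWeight_le_one hβ fun j : Fin (N p) => r.1 j
        _ = _ := by simp
    rw [Fintype.sum_sum_type, Fintype.sum_sigma]
    have h1 : ∑ a : Fin k, W (Sum.inl a) = 1 / 2 := by
      simp only [W, Sum.elim_inl, Finset.sum_const, Finset.card_univ, Fintype.card_fin,
        nsmul_eq_mul]
      field_simp
    have h2 : ∑ p : F₀, ∑ c : R p × (Fin (N p) → Fin k), W (Sum.inr ⟨p, c⟩) ≤ 1 / 2 := by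
      calc _ ≤ ∑ p : F₀, 3 * Real.exp s * Real.exp (-s * p.1.2) :=
            Finset.sum_le_sum fun p _ => hball p
        _ = 3 * Real.exp s * ∑ p ∈ F₀, Real.exp (-s * p.2) := by
            rw [← Finset.mul_sum, Finset.sum_coe_sort F₀ fun p => Real.exp (-s * p.2)]
        _ ≤ 3 * Real.exp s * (Real.exp (-s) / 6) := by
            gcongr
            exact hFsum F₀ hF₀
        _ = 1 / 2 := by
            rw [Real.exp_neg]
            field_simp
            norm_num
    linarith
  refine (limsup_partEnt_le_of_code μ (φ 1) (hinv 1) P hP g hg0 hgi dec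
    (fun c => ENNReal.ofReal (W c)) ?_ (F₀.sup N + 1) ?_).trans (ENNReal.ofReal_le_ofReal hgint)
  · rw [tsum_fintype, ← ENNReal.ofReal_sum_of_nonneg fun c _ => hW0 c]
    exact ENNReal.ofReal_le_one.2 hWsum
  intro y
  by_cases hy : y ∈ K
  · obtain ⟨p, hp, α, hα, hcl⟩ := mem_iUnion₂.1 (hKF₀ hy)
    have hp1 : (1 : ℝ) ≤ p.2 := by simpa using hF1 p (hF₀ hp)
    have hNp : (N p : ℝ) ≤ p.2 := Nat.floor_le (by linarith)
    have hsub : Icc (0 : ℝ) (N p) ⊆ Icc 0 p.2 := Icc_subset_Icc_right hNp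
    have hm' : 0 < m := by exact_mod_cast hm0
    obtain ⟨r, hr, hrj⟩ := hR p (N p) (Nat.lt_succ_iff.1 (by
        have := Nat.lt_div_mul_add (a := N p) hm'
        rw [add_mul]
        omega)) y α (hα.1.mono hsub) (fun t ht => hcl t (hsub ht)) hα.2.2
    refine ⟨Sum.inr ⟨⟨p, hp⟩, ⟨r, hr⟩, fun j => P ((φ 1)^[(j : ℕ)] y)⟩, N p,
      Nat.floor_pos.2 hp1, (Finset.le_sup hp).trans (Nat.le_succ _),
      ofFn_eq_itinerary (φ 1) P (N p) y, ENNReal.ofReal_le_ofReal ?_⟩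
    have hterm : ∀ j : Fin (N p), Real.exp (-(β + Gᶜ.indicator (fun _ => L) ((φ 1)^[(j : ℕ)] y))) ≤
        letterWeight k β (P ((φ 1)^[(j : ℕ)] y)) (r j) := by
      intro j
      by_cases hj : (φ 1)^[(j : ℕ)] y ∈ G
      · rw [hrj j j.2 hj, Set.indicator_of_notMem (by simpa using hj), letterWeight, if_pos rfl,
          add_zero]
      · rw [Set.indicator_of_mem (by simpa using hj)]
        exact exp_neg_le_letterWeight hk hβ _ _
    calc Real.exp (-∑ j ∈ Finset.range (N p), g ((φ 1)^[j] y))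
        ≤ Real.exp (-(s + κ) * N p +
            ∑ j : Fin (N p), -(β + Gᶜ.indicator (fun _ => L) ((φ 1)^[(j : ℕ)] y))) := by
          refine Real.exp_le_exp.2 ?_
          rw [Finset.sum_range, ← Finset.sum_neg_distrib]
          have hconst : -(s + κ) * N p = ∑ _j : Fin (N p), -(s + κ) := by
            rw [Finset.sum_const, Finset.card_univ, Fintype.card_fin, nsmul_eq_mul, mul_comm]
          rw [hconst, ← Finset.sum_add_distrib]
          refine Finset.sum_le_sum fun j _ => ?_
          have := hindK ((φ 1)^[(j : ℕ)] y)
          simp only [hg]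
          linarith
      _ = E p * ∏ j : Fin (N p),
            Real.exp (-(β + Gᶜ.indicator (fun _ => L) ((φ 1)^[(j : ℕ)] y))) := by
          rw [Real.exp_add, Real.exp_sum]
      _ ≤ _ := mul_le_mul_of_nonneg_left
          (Finset.prod_le_prod (fun _ _ => (Real.exp_pos _).le) fun j _ => hterm j)
          (Real.exp_pos _).le
  · refine ⟨Sum.inl (P y), 1, le_rfl, Nat.le_add_left _ _, rfl, ENNReal.ofReal_le_ofReal ?_⟩
    have h1 : L' ≤ g y := by
      simp only [hg]
      rw [Set.indicator_of_mem (s := Kᶜ) (by simpa using hy)]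
      linarith [hindG y]
    have h2 : Real.exp (-L') = 1 / (2 * k) := by
      rw [hL', Real.exp_neg, Real.exp_log (by positivity), one_div]
    simp only [Finset.sum_range_one, Function.iterate_zero, id_eq, W, Sum.elim_inl]
    rw [← h2]
    exact Real.exp_le_exp.2 (by linarith)

/-- **Theorem.** For a compact metric flow `φ` without fixed points and a `φ`-invariant
Borel probability measure `μ`, if `μ(Y) = 1` then `h_μ(φ₁) ≤ h_top^B(φ, Y)`. -/
theorem kolSinai_le_bowenEntropy_of_full_measure {X : Type*} [MetricSpace X] [CompactSpace X]
    [MeasurableSpace X] [BorelSpace X] (φ : ℝ → X → X) (hφ : IsFlow φ)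
    (hfp : FixedPointFree φ) (μ : Measure X) [IsProbabilityMeasure μ]
    (hinv : FlowInvariant φ μ) (Y : Set X) (hY : μ Y = 1) :
    kolSinai μ (φ 1) ≤ bowenEntropy φ Y := by
  refine iSup_le fun k => iSup₂_le fun P hP => le_iInf fun s => le_iInf₂ fun hs hM => ?_
  have hlim : Tendsto (fun β : ℝ => ENNReal.ofReal (s + 4 * β)) (𝓝[>] 0) (𝓝 (ENNReal.ofReal s)) := by
    refine ENNReal.tendsto_ofReal (Tendsto.mono_left ?_ nhdsWithin_le_nhds)
    have : Continuous fun β : ℝ => s + 4 * β := by fun_prop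
    simpa using this.tendsto 0
  refine ge_of_tendsto hlim ?_
  filter_upwards [self_mem_nhdsWithin] with β hβ
  exact limsup_partEnt_le_of_coverMlim_eq_zero hφ hfp μ hinv hY hs hM P hP hβ

end FlowEntropy
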